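/- Let G be an equatorial graph with minimum degree δ, girth g and equator q. If the partition of G induced by its isometric cycles of length q has a part L_i containing only a single vertex, then there exists a δ-regular Moore graph with girth g, i.e. a finite connected simple δ-regular graph with girth g and order M(δ, g). -/

import Mathlib

open SimpleGraph

/-- The distance between two indices around a cycle of length `q`. -/
def cycleDist {q : ℕ} (i j : ZMod q) : ℕ := min (i - j).val (j - i).val

/-- `f` lists the vertices (in cyclic order) of an isometric cycle of length `q` in `G`:
the distance in `G` between any two of its vertices equals their distance along the cycle. -/
def IsIsoCycle {V : Type*} (G : SimpleGraph V) (q : ℕ) (f : ZMod q → V) : Prop :=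
  3 ≤ q ∧ ∀ i j : ZMod q, G.dist (f i) (f j) = cycleDist i j

/-- `G` has an isometric cycle of length `q`. -/
def HasIsoCycle {V : Type*} (G : SimpleGraph V) (q : ℕ) : Prop :=
  ∃ f : ZMod q → V, IsIsoCycle G q f

/-- The equator of `G` is `q`: `q` is the length of a longest isometric cycle of `G`
(`0` if `G` has no isometric cycle, e.g. if `G` is acyclic). -/
def IsEquator {V : Type*} (G : SimpleGraph V) (q : ℕ) : Prop :=
  (HasIsoCycle G q ∨ (q = 0 ∧ ∀ q', ¬ HasIsoCycle G q')) ∧ ∀ q', HasIsoCycle G q' → q' ≤ q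

/-- The degree of a vertex, as the cardinality of its neighbor set. -/
noncomputable def ndeg {V : Type*} (G : SimpleGraph V) (v : V) : ℕ := (G.neighborSet v).ncard

/-- `G` has minimum degree `δ`. -/
def HasMinDegree {V : Type*} (G : SimpleGraph V) (δ : ℕ) : Prop :=
  (∀ v, δ ≤ ndeg G v) ∧ ∃ v, ndeg G v = δ

/-- The Moore bound `M(δ, g)`. -/
def mooreBound (δ g : ℕ) : ℕ :=
  if Odd g then 1 + δ * ∑ i ∈ Finset.range ((g + 1) / 2 - 1), (δ - 1) ^ i
  else 2 + ∑ i ∈ Finset.Icc 1 ((g + 1) / 2 - 1), 2 * (δ - 1) ^ i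

/-- The disk of radius `k` around a vertex `u`. -/
def disk {V : Type*} (G : SimpleGraph V) (k : ℕ) (u : V) : Set V := {v | G.dist u v ≤ k}

/-- The disk of radius `k` around an edge `uv`. -/
def edisk {V : Type*} (G : SimpleGraph V) (k : ℕ) (u v : V) : Set V :=
  disk G k u ∪ disk G k v

/-- `G` is an equatorial graph with minimum degree `δ`, girth `g` and equator `q`:
a finite connected simple graph with girth `g`, minimum degree `δ`, equator `q > 6k + 3`
(where `k = ⌈g/2⌉ - 1`) whose order attains the bound `n = (q/g) · M(δ, g)`. -/
def IsEquatorial {V : Type*} (G : SimpleGraph V) (δ g q : ℕ) : Prop :=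
  Finite V ∧ G.Connected ∧ G.girth = g ∧ HasMinDegree G δ ∧ IsEquator G q ∧
    6 * ((g + 1) / 2 - 1) + 3 < q ∧ g * Nat.card V = q * mooreBound δ g

/-- The part `L i` of the partition induced by the isometric cycle `f`:
`L i = D_k(u_{i-k}) ∩ D_k(u_{i+k})`. -/
def Lpart {V : Type*} (G : SimpleGraph V) (k : ℕ) {q : ℕ} (f : ZMod q → V) (i : ZMod q) :
    Set V :=
  disk G k (f (i - (k : ZMod q))) ∩ disk G k (f (i + (k : ZMod q)))

namespace SimpleGraph

variable {V : Type*} {G : SimpleGraph V}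

/-- Two distinct paths with the same ends close up to a cycle. -/
theorem Walk.IsPath.egirth_le_length_add_length {a b : V} {p q : G.Walk a b} (hp : p.IsPath)
    (hq : q.IsPath) (hne : p ≠ q) : G.egirth ≤ (p.length + q.length : ℕ) := by
  classical
  set K : SimpleGraph V := fromEdgeSet {e | e ∈ p.edges ++ q.edges} with hK
  have hKG : K ≤ G := by
    intro u v huv
    simp only [hK, fromEdgeSet_adj, Set.mem_ofPred_eq, List.mem_append] at huv
    exact huv.1.elim (p.adj_of_mem_edges) (q.adj_of_mem_edges)
  have hmem : ∀ e ∈ p.edges ++ q.edges, e ∈ K.edgeSet := by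
    intro e he
    have heG : e ∈ G.edgeSet :=
      (List.mem_append.1 he).elim (p.edges_subset_edgeSet ·) (q.edges_subset_edgeSet ·)
    rw [hK, edgeSet_fromEdgeSet]
    exact ⟨he, G.not_isDiag_of_mem_edgeSet heG⟩
  have hpK : ∀ e ∈ p.edges, e ∈ K.edgeSet := fun e he ↦ hmem e (List.mem_append_left _ he)
  have hqK : ∀ e ∈ q.edges, e ∈ K.edgeSet := fun e he ↦ hmem e (List.mem_append_right _ he)
  by_cases hac : K.IsAcyclic
  · have h := congrArg (fun r : K.Path a b ↦ r.1.support) ((hac.subsingleton_path a b).elim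
      ⟨p.transfer K hpK, hp.transfer hpK⟩ ⟨q.transfer K hqK, hq.transfer hqK⟩)
    simp only [Walk.support_transfer] at h
    exact absurd (Walk.ext_support h) hne
  · simp only [IsAcyclic, not_forall, not_not] at hac
    obtain ⟨v, c, hc⟩ := hac
    have hsub : c.edges ⊆ p.edges ++ q.edges := fun e he ↦ by
      have := c.edges_subset_edgeSet he
      rw [hK, edgeSet_fromEdgeSet] at this
      exact this.1
    have hlen := (hc.edges_nodup.subperm hsub).length_le
    rw [List.length_append, Walk.length_edges, Walk.length_edges, Walk.length_edges] at hlen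
    refine (egirth_le_length (hc.mapLe hKG)).trans ?_
    rw [Walk.length_mapLe]
    exact_mod_cast hlen

/-- Below half the girth, a vertex has at most one neighbour that is not further away from `v`. -/
theorem egirth_le_of_adj_of_adj {v x y z : V} (hr : G.Reachable v x) (hxy : G.Adj x y)
    (hxz : G.Adj x z) (hyz : y ≠ z) (hy : G.dist v y ≤ G.dist v x)
    (hz : G.dist v z ≤ G.dist v x) :
    G.egirth ≤ (2 + G.dist v y + G.dist v z : ℕ) := by
  have key : ∀ w, G.Adj x w → G.dist v w ≤ G.dist v x →
      ∃ p : G.Walk w v, ∀ h : G.Adj x w, (p.cons h).IsPath ∧ p.length = G.dist v w := by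
    intro w hw hwx
    obtain ⟨p, hp, hpl⟩ := ((hr.trans hw.reachable).symm).exists_path_of_dist
    rw [dist_comm] at hpl
    refine ⟨p, fun h ↦ ⟨(Walk.cons_isPath_iff _ _).2 ⟨hp, fun hx ↦ ?_⟩, hpl⟩⟩
    classical
    have h1 := congrArg Walk.length (p.take_spec hx)
    rw [Walk.length_append] at h1
    have h2 := dist_le (p.dropUntil x hx)
    have h3 : (p.takeUntil x hx).length ≠ 0 := fun h0 ↦ h.ne (Walk.eq_of_length_eq_zero h0).symm
    rw [dist_comm] at h2
    omega
  obtain ⟨p, hp⟩ := key y hxy hy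
  obtain ⟨r, hr⟩ := key z hxz hz
  obtain ⟨hp, hpl⟩ := hp hxy
  obtain ⟨hr, hrl⟩ := hr hxz
  have := hp.egirth_le_length_add_length hr (fun h ↦ hyz (by
    have := congrArg Walk.snd h
    simpa using this))
  rw [Walk.length_cons, Walk.length_cons, hpl, hrl] at this
  refine this.trans (by norm_cast; omega)

/-- Spheres of radius below half the girth grow at least like in a tree. -/
theorem mul_ncard_sphere_le [Finite V] {v : V} {δ j : ℕ} (hj : 0 < j)
    (hg : (2 * j + 3 : ℕ) ≤ G.egirth) (hδ : ∀ x, G.dist v x = j → δ ≤ ndeg G x) :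
    (δ - 1) * {x | G.dist v x = j}.ncard ≤ {x | G.dist v x = j + 1}.ncard := by
  classical
  have := Fintype.ofFinite V
  have hcard : ∀ (p : V → Prop) [DecidablePred p], {x | p x}.ncard = (Finset.univ.filter p).card :=
      fun p _ ↦ by
      rw [← Set.ncard_coe_finset]; simp
  have hreach : ∀ {x}, 0 < G.dist v x → G.Reachable v x := fun h ↦
    Reachable.of_dist_ne_zero h.ne'
  rw [hcard, hcard, mul_comm]
  refine le_trans (Finset.card_mul_le_card_mul G.Adj (n := 1) ?_ ?_) (mul_one _).le
  · intro x hx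
    simp only [Finset.mem_filter, Finset.mem_univ, true_and] at hx
    have hnb := hδ x hx
    rw [ndeg, Set.ncard_eq_toFinset_card'] at hnb
    have hle : ((G.neighborSet x).toFinset.filter (fun y ↦ G.dist v y ≤ j)).card ≤ 1 := by
      rw [Finset.card_le_one]
      intro y hy z hz
      simp only [Finset.mem_filter, Set.mem_toFinset, mem_neighborSet] at hy hz
      by_contra hyz
      have hle := hg.trans (egirth_le_of_adj_of_adj (hreach (by omega)) hy.1 hz.1 hyz
        (by omega) (by omega))
      norm_cast at hle
      omega
    have heq : (Finset.univ.filter (fun y ↦ G.dist v y = j + 1)).bipartiteAbove G.Adj x =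
        (G.neighborSet x).toFinset.filter (fun y ↦ ¬ G.dist v y ≤ j) := by
      ext y
      simp only [Finset.mem_bipartiteAbove, Finset.mem_filter, Finset.mem_univ, true_and,
        Set.mem_toFinset, mem_neighborSet]
      refine ⟨fun h ↦ ⟨h.2, by omega⟩, fun h ↦ ⟨?_, h.1⟩⟩
      have := (hreach (x := x) (by omega)).dist_triangle_left y
      rw [dist_eq_one_iff_adj.2 h.1] at this
      omega
    rw [heq]
    have := Finset.card_filter_add_card_filter_not (s := (G.neighborSet x).toFinset)
      (fun y ↦ G.dist v y ≤ j)
    omega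
  · intro y hy
    simp only [Finset.mem_filter, Finset.mem_univ, true_and] at hy
    rw [Finset.card_le_one]
    intro x hx z hz
    simp only [Finset.mem_bipartiteBelow, Finset.mem_filter, Finset.mem_univ, true_and] at hx hz
    by_contra hxz
    have hle := hg.trans (egirth_le_of_adj_of_adj (hreach (by omega)) hx.2.symm hz.2.symm hxz
      (by omega) (by omega))
    norm_cast at hle
    omega

/-- The Moore bound for the disk around a vertex of prescribed degree. -/
theorem le_ncard_ball [Finite V] {v : V} {δ : ℕ} (k : ℕ) (hg : (2 * k + 1 : ℕ) ≤ G.egirth)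
    (hδ : ∀ x, 0 < G.dist v x → G.dist v x < k → δ ≤ ndeg G x) :
    1 + ndeg G v * ∑ i ∈ Finset.range k, (δ - 1) ^ i ≤
      {x | G.Reachable v x ∧ G.dist v x ≤ k}.ncard := by
  have hone : {x | G.dist v x = 1} = G.neighborSet v := by
    ext x; simp [dist_eq_one_iff_adj]
  have hsph : ∀ i < k, ndeg G v * (δ - 1) ^ i ≤ {x | G.dist v x = i + 1}.ncard := by
    intro i
    induction i with
    | zero => intro _; rw [zero_add, hone, pow_zero, mul_one, ndeg]
    | succ i ih =>
      intro hi
      refine le_trans ?_ (mul_ncard_sphere_le (δ := δ) (Nat.succ_pos i)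
        (le_trans (by norm_cast; omega) hg) fun x hx ↦ hδ x (by omega) (by omega))
      calc _ = (δ - 1) * (ndeg G v * (δ - 1) ^ i) := by ring
        _ ≤ _ := Nat.mul_le_mul_left _ (ih (by omega))
  clear hδ hg
  induction k with
  | zero =>
    simp only [Finset.range_zero, Finset.sum_empty, mul_zero, add_zero]
    exact (Set.ncard_pos (Set.toFinite _)).2 ⟨v, by simp⟩
  | succ k ih =>
    have hset : {x | G.Reachable v x ∧ G.dist v x ≤ k + 1} =
        {x | G.Reachable v x ∧ G.dist v x ≤ k} ∪ {x | G.dist v x = k + 1} := by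
      ext x
      simp only [Set.mem_ofPred_eq, Set.mem_union]
      constructor
      · rintro ⟨h1, h2⟩
        rcases h2.lt_or_eq with h | h
        · exact .inl ⟨h1, by omega⟩
        · exact .inr h
      · rintro (h | h)
        · exact ⟨h.1, by omega⟩
        · exact ⟨Reachable.of_dist_ne_zero (by omega), h.le⟩
    rw [hset, Set.ncard_union_eq (Set.disjoint_left.2 fun x h1 h2 ↦ by
      simp only [Set.mem_ofPred_eq] at h1 h2; omega) (Set.toFinite _) (Set.toFinite _),
      Finset.sum_range_succ, mul_add, ← add_assoc]
    exact add_le_add (ih fun i hi ↦ hsph i (by omega)) (hsph k (by omega))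

/-- Half of the Moore bound for the disk around an edge: the vertices that are within distance `k`
of `v` without using the edge `vw`. -/
theorem le_ncard_ball_deleteEdges [Finite V] {v w : V} {δ : ℕ} (k : ℕ)
    (hδ : ∀ x, δ ≤ ndeg G x) (hg : (2 * k + 1 : ℕ) ≤ G.egirth)
    (hlong : ∀ p : (G.deleteEdges {s(v, w)}).Walk v w, k ≤ p.length) :
    1 + (ndeg G v - 1) * ∑ i ∈ Finset.range k, (δ - 1) ^ i ≤
      {x | (G.deleteEdges {s(v, w)}).Reachable v x ∧
        (G.deleteEdges {s(v, w)}).dist v x ≤ k}.ncard := by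
  have hle := deleteEdges_le (G := G) {s(v, w)}
  refine le_trans ?_ (le_ncard_ball (G := G.deleteEdges {s(v, w)}) (δ := δ) k
    (hg.trans (egirth_anti hle)) ?_)
  · have : ndeg G v - 1 ≤ ndeg (G.deleteEdges {s(v, w)}) v := by
      rw [ndeg, ndeg]
      refine (Set.pred_ncard_le_ncard_sdiff_singleton _ w).trans
        (Set.ncard_le_ncard ?_ (Set.toFinite _))
      rintro y ⟨hy, hyw⟩
      simp only [mem_neighborSet, deleteEdges_adj, Set.mem_singleton_iff] at hy hyw ⊢
      refine ⟨hy, fun h ↦ ?_⟩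
      rcases Sym2.eq_iff.1 h with h | h
      · exact hyw h.2
      · exact hy.ne h.2.symm
    gcongr
  · intro x hx hxk
    refine (hδ x).trans (Set.ncard_le_ncard ?_ (Set.toFinite _))
    intro y hy
    simp only [mem_neighborSet, deleteEdges_adj, Set.mem_singleton_iff] at hy ⊢
    refine ⟨hy, fun h ↦ ?_⟩
    rcases Sym2.eq_iff.1 h with h | h
    · rw [h.1, dist_self] at hx
      exact hx.false
    · obtain ⟨p, hp⟩ := exists_walk_of_dist_ne_zero hx.ne'
      have := hlong (p.copy rfl h.1)
      rw [Walk.length_copy] at this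
      omega

/-- The Moore bound for the disk around an edge whose ends have prescribed degrees. -/
theorem le_ncard_edisk [Finite V] {v w : V} {δ : ℕ} (k : ℕ) (hvw : G.Adj v w)
    (hδ : ∀ x, δ ≤ ndeg G x) (hg : (2 * k + 2 : ℕ) ≤ G.egirth) :
    2 + ((ndeg G v - 1) + (ndeg G w - 1)) * ∑ i ∈ Finset.range k, (δ - 1) ^ i ≤
      (edisk G k v w).ncard := by
  classical
  set K := G.deleteEdges {s(v, w)} with hK
  have hle : K ≤ G := deleteEdges_le (G := G) {s(v, w)}
  have hlong : ∀ p : K.Walk v w, 2 * k + 1 ≤ p.length := by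
    intro p
    have h := (p.bypass_isPath.mapLe hle).egirth_le_length_add_length
      (Path.singleton hvw).2 (fun h ↦ by
        have hmem : s(v, w) ∈ (p.bypass.mapLe hle).edges := by
          rw [h]; simp [Path.singleton]
        rw [Walk.edges_mapLe_eq_edges] at hmem
        have := p.bypass.adj_of_mem_edges hmem
        simp [hK] at this)
    have h := hg.trans h
    rw [Walk.length_mapLe] at h
    have h2 := p.length_bypass_le_length
    simp only [Path.singleton, Walk.length_cons, Walk.length_nil] at h
    norm_cast at h
    omega
  have hg' : (2 * k + 1 : ℕ) ≤ G.egirth := le_trans (by norm_cast; omega) hg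
  have h1 := le_ncard_ball_deleteEdges (v := v) (w := w) k hδ hg' fun p ↦ by
    have := hlong p
    omega
  have hswap : G.deleteEdges {s(w, v)} = K := by rw [hK, Sym2.eq_swap]
  have h2 := le_ncard_ball_deleteEdges (v := w) (w := v) k hδ hg' fun p ↦ by
    have := hlong (p.mapLe hswap.le).reverse
    rw [Walk.length_reverse, Walk.length_mapLe] at this
    omega
  rw [hswap] at h2
  rw [← hK] at h1
  have hdisj : Disjoint {x | K.Reachable v x ∧ K.dist v x ≤ k}
      {x | K.Reachable w x ∧ K.dist w x ≤ k} := by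
    rw [Set.disjoint_left]
    rintro x ⟨hvx, hvx'⟩ ⟨hwx, hwx'⟩
    obtain ⟨p, hp⟩ := hvx.exists_walk_length_eq_dist
    obtain ⟨r, hr⟩ := hwx.exists_walk_length_eq_dist
    have := hlong (p.append r.reverse)
    rw [Walk.length_append, Walk.length_reverse] at this
    omega
  have hsub : {x | K.Reachable v x ∧ K.dist v x ≤ k} ∪ {x | K.Reachable w x ∧ K.dist w x ≤ k} ⊆
      edisk G k v w := by
    rintro x (⟨hx, hx'⟩ | ⟨hx, hx'⟩)
    · exact .inl ((hx.dist_anti hle).trans hx')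
    · exact .inr ((hx.dist_anti hle).trans hx')
  have h3 := Set.ncard_le_ncard hsub (Set.toFinite _)
  rw [Set.ncard_union_eq hdisj (Set.toFinite _) (Set.toFinite _)] at h3
  rw [add_mul]
  omega

theorem mooreBound_of_odd {δ g k : ℕ} (hg : Odd g) (hk : k = (g + 1) / 2 - 1) :
    mooreBound δ g = 1 + δ * ∑ i ∈ Finset.range k, (δ - 1) ^ i := by
  rw [mooreBound, if_pos hg, hk]

theorem mooreBound_of_not_odd {δ g k : ℕ} (hg : ¬ Odd g) (hk : k = (g + 1) / 2 - 1) :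
    mooreBound δ g = 2 + ((δ - 1) + (δ - 1)) * ∑ i ∈ Finset.range k, (δ - 1) ^ i := by
  rw [mooreBound, if_neg hg, ← hk]
  clear hk
  congr 1
  induction k with
  | zero => simp
  | succ k ih =>
    rw [Finset.sum_Icc_succ_top (by omega), ih, Finset.sum_range_succ]
    ring

/-- The Moore bound holds for disks around vertices (odd girth) or edges (even girth). -/
theorem mooreBound_le_ncard [Finite V] {δ g k : ℕ} (hg : (g : ℕ∞) ≤ G.egirth) (hg3 : 3 ≤ g)
    (hk : k = (g + 1) / 2 - 1) (hδ : ∀ x, δ ≤ ndeg G x) {v w : V} (hvw : G.Adj v w) :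
    mooreBound δ g ≤ (if Odd g then disk G k v else edisk G k v w).ncard := by
  split_ifs with hodd
  · rw [mooreBound_of_odd hodd hk]
    obtain ⟨m, rfl⟩ := hodd
    obtain rfl : k = m := by omega
    refine le_trans ?_ ((le_ncard_ball (v := v) k hg fun x _ _ ↦ hδ x).trans
      (Set.ncard_le_ncard (fun x hx ↦ hx.2) (Set.toFinite _)))
    gcongr
    exact hδ v
  · rw [mooreBound_of_not_odd hodd hk]
    rw [Nat.not_odd_iff_even] at hodd
    obtain ⟨m, rfl⟩ := hodd
    refine le_trans ?_ (le_ncard_edisk k hvw hδ (le_trans (by norm_cast; omega) hg))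
    gcongr <;> apply hδ

/-- A graph attaining the Moore bound is regular. -/
theorem ndeg_eq_of_card_eq_mooreBound [Finite V] {δ g : ℕ} (hg : (g : ℕ∞) ≤ G.egirth)
    (hg3 : 3 ≤ g) (hδ0 : 0 < δ) (hδ : ∀ x, δ ≤ ndeg G x) (hcard : Nat.card V = mooreBound δ g)
    (v : V) : ndeg G v = δ := by
  obtain ⟨k, hk⟩ : ∃ k, k = (g + 1) / 2 - 1 := ⟨_, rfl⟩
  have hpos : 0 < ∑ i ∈ Finset.range k, (δ - 1) ^ i :=
    Finset.sum_pos' (fun _ _ ↦ Nat.zero_le _) ⟨0, by simp; omega, by simp⟩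
  by_contra hne
  have hlt : δ < ndeg G v := lt_of_le_of_ne (hδ v) (Ne.symm hne)
  by_cases hodd : Odd g
  · rw [mooreBound_of_odd hodd hk] at hcard
    obtain ⟨m, rfl⟩ := hodd
    obtain rfl : k = m := by omega
    have h1 := (le_ncard_ball (v := v) k hg fun x _ _ ↦ hδ x).trans (Set.ncard_le_card _)
    have h2 := Nat.mul_lt_mul_of_pos_right hlt hpos
    omega
  · rw [mooreBound_of_not_odd hodd hk] at hcard
    rw [Nat.not_odd_iff_even] at hodd
    obtain ⟨m, rfl⟩ := hodd
    obtain ⟨w, hvw⟩ : (G.neighborSet v).Nonempty :=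
      (Set.ncard_pos (Set.toFinite _)).1 (Nat.zero_lt_of_lt hlt)
    have h1 := (le_ncard_edisk k hvw hδ (le_trans (by norm_cast; omega) hg)).trans
      (Set.ncard_le_card _)
    have hw := hδ w
    have h2 : (δ - 1) + (δ - 1) < (ndeg G v - 1) + (ndeg G w - 1) := by omega
    have h2 := Nat.mul_lt_mul_of_pos_right h2 hpos
    omega

end SimpleGraph

section Levels

variable {q : ℕ}

theorem ZMod.eq_of_intCast_eq {a b : ℤ} (h : (a : ZMod q) = b) (hlt : |b - a| < q) : a = b := by
  have := Int.eq_zero_of_abs_lt_dvd ((ZMod.intCast_eq_intCast_iff_dvd_sub a b q).1 h) hlt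
  omega

theorem exists_int_of_cycleDist_le [NeZero q] {i j : ZMod q} {m : ℕ} (h : cycleDist i j ≤ m) :
    ∃ e : ℤ, |e| ≤ m ∧ j = i + e := by
  rcases min_le_iff.1 h with h | h
  · refine ⟨-((i - j).val : ℤ), by rw [abs_neg, Nat.abs_cast]; exact_mod_cast h, ?_⟩
    simp
  · refine ⟨((j - i).val : ℤ), by rw [Nat.abs_cast]; exact_mod_cast h, ?_⟩
    simp

theorem cycleDist_add_natCast_le (i : ZMod q) (n : ℕ) : cycleDist i (i + n) ≤ n := by
  refine (min_le_right _ _).trans ?_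
  rw [add_sub_cancel_left, ZMod.val_natCast]
  exact Nat.mod_le n q

/-- A set of residues that are pairwise close lies in a short arc. -/
theorem exists_arc_of_cycleDist_le [NeZero q] {k : ℕ} (hq : 6 * k < q) (S : Set (ZMod q))
    (hS : ∀ s ∈ S, ∀ t ∈ S, cycleDist s t ≤ 2 * k) :
    ∃ t : ZMod q, ∀ s ∈ S, ∃ j : ℕ, j ≤ 2 * k ∧ s = t + j := by
  classical
  rcases S.eq_empty_or_nonempty with rfl | ⟨s₀, hs₀⟩
  · exact ⟨0, by simp⟩
  have hex : ∃ a : ℕ, s₀ - (2 * k : ℕ) + a ∈ S := ⟨2 * k, by simpa using hs₀⟩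
  refine ⟨s₀ - (2 * k : ℕ) + Nat.find hex, fun s hs ↦ ?_⟩
  obtain ⟨e, he, hse⟩ := exists_int_of_cycleDist_le (hS s₀ hs₀ s hs)
  obtain ⟨e', he', hse'⟩ := exists_int_of_cycleDist_le (hS _ (Nat.find_spec hex) s hs)
  rw [abs_le] at he he'
  have hmin : Nat.find hex ≤ (e + 2 * k).toNat := by
    apply Nat.find_min'
    have : (((e + 2 * k).toNat : ℤ) : ZMod q) = e + 2 * k := by
      rw [Int.toNat_of_nonneg (by omega)]; push_cast; ring
    rw [Int.cast_natCast] at this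
    rw [this]
    convert hs using 1
    rw [hse]; push_cast; ring
  have heq : e' = e + 2 * k - Nat.find hex := by
    apply ZMod.eq_of_intCast_eq (q := q)
    · have h := hse'.symm.trans hse
      push_cast at h ⊢
      linear_combination h
    · rw [abs_lt]; push_cast at *; omega
  refine ⟨e'.toNat, by omega, ?_⟩
  have : ((e'.toNat : ℤ) : ZMod q) = e' := by rw [Int.toNat_of_nonneg (by omega)]
  rw [Int.cast_natCast] at this
  rw [this, ← hse']

variable {V : Type*} {G : SimpleGraph V} {f : ZMod q → V} {g k : ℕ}

/-- The disk of the cycle `f` at position `i`: around a vertex of the cycle if the girth `g` is odd,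
around an edge if it is even. -/
def cycleDisk (G : SimpleGraph V) (g k : ℕ) (f : ZMod q → V) (i : ZMod q) : Set V :=
  if Odd g then disk G k (f i) else edisk G k (f i) (f (i + 1))

/-- The vertex `v` is on level `c` with respect to the cycle `f`. -/
structure IsLevel (G : SimpleGraph V) (g k : ℕ) (f : ZMod q → V) (v : V) (c : ZMod q) : Prop where
  dist_sub : G.dist (f (c - k)) v ≤ k
  dist_add : G.dist (f (c + k)) v ≤ k
  exists_of_dist_le : ∀ s, G.dist (f s) v ≤ k → ∃ e : ℤ, |e| ≤ k ∧ s = c + e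
  mem_cycleDisk_iff : ∀ i, v ∈ cycleDisk G g k f i ↔ ∃ j < g, c = i - k + (j : ℕ)

theorem IsIsoCycle.neZero (hf : IsIsoCycle G q f) : NeZero q := ⟨by have := hf.1; omega⟩

theorem IsIsoCycle.cycleDist_le (hf : IsIsoCycle G q f) (hG : G.Connected) {i j : ZMod q} {v w : V}
    {a b c : ℕ} (hv : G.dist (f i) v ≤ a) (hw : G.dist (f j) w ≤ b) (hvw : G.dist v w ≤ c) :
    cycleDist i j ≤ a + c + b := by
  rw [← hf.2]
  have h1 := hG.dist_triangle (u := f i) (v := v) (w := f j)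
  have h2 := hG.dist_triangle (u := v) (v := w) (w := f j)
  rw [G.dist_comm (u := f j)] at hw
  omega

theorem IsIsoCycle.adj (hf : IsIsoCycle G q f) (i : ZMod q) : G.Adj (f i) (f (i + 1)) := by
  have := hf.neZero
  have hq := hf.1
  have : Fact (1 < q) := ⟨by omega⟩
  rw [← dist_eq_one_iff_adj, hf.2]
  refine le_antisymm (by simpa using cycleDist_add_natCast_le i 1) ?_
  rw [Nat.one_le_iff_ne_zero, cycleDist]
  intro h
  rcases Nat.min_eq_zero_iff.1 h with h | h <;> simp at h

/-- Every vertex lies in at most `g` disks of the cycle; if it lies in exactly `g`, it has a level. -/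
theorem ncard_cycleDisk_le_and_exists_isLevel (hf : IsIsoCycle G q f) (hG : G.Connected) (hg : 3 ≤ g)
    (hk : k = (g + 1) / 2 - 1) (hq : 6 * k + 3 < q) (v : V) :
    {i | v ∈ cycleDisk G g k f i}.ncard ≤ g ∧
      ({i | v ∈ cycleDisk G g k f i}.ncard = g → ∃ c, IsLevel G g k f v c) := by
  classical
  have := hf.neZero
  obtain ⟨t, ht⟩ := exists_arc_of_cycleDist_le (q := q) (k := k) (by omega)
    {i | G.dist (f i) v ≤ k} (fun s hs t ht ↦ by
      have := hf.cycleDist_le hG hs ht (G.dist_self).le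
      omega)
  set W : Finset (ZMod q) := (Finset.range g).image (fun j : ℕ ↦ t + 2 * k - j) with hW
  have hWcard : (W : Set (ZMod q)).ncard ≤ g := by
    rw [Set.ncard_coe_finset]
    exact Finset.card_image_le.trans (by simp)
  have hmem : ∀ i, v ∈ cycleDisk G g k f i ↔
      G.dist (f i) v ≤ k ∨ (¬ Odd g ∧ G.dist (f (i + 1)) v ≤ k) := by
    intro i
    rw [cycleDisk]
    split_ifs with h <;> simp [h, edisk, disk]
  have hsub : {i | v ∈ cycleDisk G g k f i} ⊆ (W : Set (ZMod q)) := by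
    intro i hi
    rw [Set.mem_ofPred_eq, hmem] at hi
    rw [hW, Finset.mem_coe, Finset.mem_image]
    rcases hi with hi | ⟨hodd, hi⟩
    · obtain ⟨j, hj, hij⟩ := ht _ hi
      refine ⟨2 * k - j, by simp; omega, ?_⟩
      rw [hij, Nat.cast_sub hj]; push_cast; ring
    · obtain ⟨j, hj, hij⟩ := ht _ hi
      rw [Nat.not_odd_iff_even] at hodd
      obtain ⟨m, rfl⟩ := hodd
      refine ⟨2 * k - j + 1, by simp; omega, ?_⟩
      rw [eq_sub_of_add_eq hij, Nat.cast_add, Nat.cast_sub hj]; push_cast; ring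
  refine ⟨(Set.ncard_le_ncard hsub (Set.toFinite _)).trans hWcard, fun hcard ↦ ?_⟩
  have heq := Set.eq_of_subset_of_ncard_le hsub (hWcard.trans hcard.ge) (Set.toFinite _)
  have hiff : ∀ i, v ∈ cycleDisk G g k f i ↔ ∃ j < g, t + 2 * k - (j : ℕ) = i := by
    intro i
    have := Set.ext_iff.1 heq i
    rw [Set.mem_ofPred_eq] at this
    rw [this, hW, Finset.mem_coe, Finset.mem_image]
    simp
  have hwin : ∀ e : ℤ, -1 ≤ e → e ≤ 2 * k + 1 → G.dist (f (t + e)) v ≤ k → 0 ≤ e ∧ e ≤ 2 * k := by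
    intro e h1 h2 h3
    obtain ⟨j, hj, hj'⟩ := ht _ h3
    have := ZMod.eq_of_intCast_eq (q := q) (a := e) (b := j)
      (by simpa using hj') (by rw [abs_lt]; omega)
    omega
  have hleft : G.dist (f t) v ≤ k := by
    by_cases hodd : Odd g
    · have h := (hiff t).2 ⟨2 * k, by obtain ⟨m, rfl⟩ := hodd; omega, by push_cast; ring⟩
      rw [hmem] at h
      tauto
    · have h := (hiff (t - 1)).2 ⟨2 * k + 1, by
        rw [Nat.not_odd_iff_even] at hodd; obtain ⟨m, rfl⟩ := hodd; omega, by push_cast; ring⟩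
      rw [hmem, sub_add_cancel] at h
      rcases h with h | h
      · have := hwin (-1) (by omega) (by omega) (by simpa [← sub_eq_add_neg] using h)
        omega
      · exact h.2
  have hright : G.dist (f (t + 2 * k)) v ≤ k := by
    have h := (hiff (t + 2 * k)).2 ⟨0, by omega, by simp⟩
    rw [hmem] at h
    rcases h with h | ⟨-, h⟩
    · exact h
    · have := hwin (2 * k + 1) (by omega) (by omega) (by push_cast; rwa [← add_assoc])
      omega
  refine ⟨t + k, by simpa using hleft, by rw [add_assoc, ← two_mul]; exact hright, fun s hs ↦ ?_,
    fun i ↦ ?_⟩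
  · obtain ⟨j, hj, rfl⟩ := ht _ hs
    refine ⟨j - k, by rw [abs_le]; omega, by push_cast; ring⟩
  · rw [hiff]
    refine exists_congr fun j ↦ and_congr_right fun _ ↦ ?_
    constructor
    · rintro rfl; ring
    · intro h; linear_combination h

/-- In an equatorial graph every vertex has a level, and all disks of the cycle have the same
size. -/
theorem IsEquatorial.levels {δ : ℕ} (hG : IsEquatorial G δ g q) (hk : k = (g + 1) / 2 - 1)
    (hg : 3 ≤ g) (hf : IsIsoCycle G q f) :
    (∀ v, ∃ c, IsLevel G g k f v c) ∧ ∀ i, (cycleDisk G g k f i).ncard = mooreBound δ g := by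
  classical
  obtain ⟨hfin, hconn, hgirth, ⟨hδ, -⟩, -, hq, hcard⟩ := hG
  rw [← hk] at hq
  have := Fintype.ofFinite V
  have := hf.neZero
  have hegirth : (g : ℕ∞) ≤ G.egirth := le_egirth.2 fun a w hw ↦ by
    rw [← hgirth]; exact_mod_cast girth_le_length hw
  have hle : ∀ i, mooreBound δ g ≤ (cycleDisk G g k f i).ncard := fun i ↦
    mooreBound_le_ncard hegirth hg hk hδ (hf.adj i)
  have haux := ncard_cycleDisk_le_and_exists_isLevel hf hconn hg hk hq
  have hcount : ∑ i : ZMod q, (cycleDisk G g k f i).ncard =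
      ∑ v : V, {i | v ∈ cycleDisk G g k f i}.ncard := by
    have := Finset.sum_card_bipartiteAbove_eq_sum_card_bipartiteBelow
      (s := (Finset.univ : Finset (ZMod q))) (t := (Finset.univ : Finset V))
      (fun i v ↦ v ∈ cycleDisk G g k f i)
    convert this using 2 with i _ v _
    · rw [← Set.ncard_coe_finset]; simp
    · rw [← Set.ncard_coe_finset]; simp
  have hlow : ∑ _i : ZMod q, mooreBound δ g = ∑ _v : V, g := by
    simp only [Finset.sum_const, Finset.card_univ, ZMod.card, smul_eq_mul]
    rw [← hcard, Nat.card_eq_fintype_card, mul_comm]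
  have h1 := Finset.sum_le_sum fun i (_ : i ∈ Finset.univ) ↦ hle i
  have h2 := Finset.sum_le_sum fun v (_ : v ∈ Finset.univ) ↦ (haux v).1
  refine ⟨fun v ↦ (haux v).2 ?_, fun i ↦ ?_⟩
  · exact (Finset.sum_eq_sum_iff_of_le fun v _ ↦ (haux v).1).1 (by omega) v (Finset.mem_univ v)
  · exact ((Finset.sum_eq_sum_iff_of_le fun i _ ↦ hle i).1 (by omega) i (Finset.mem_univ i)).symm

end Levels

section Strip

variable {V : Type*} {G : SimpleGraph V} {g : ℕ} {lev : V → ℕ} {x y : V}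

/-- `lev` arranges a part of `G` into levels `0, …, g`, where the first level consists of `x` only,
the last one of `y` only, and edges join equal or consecutive levels. -/
structure IsStrip (G : SimpleGraph V) (g : ℕ) (lev : V → ℕ) (x y : V) : Prop where
  three_le : 3 ≤ g
  lev_eq_zero : ∀ a, lev a = 0 ↔ a = x
  lev_eq_top : ∀ a, lev a = g ↔ a = y
  lev_le_succ : ∀ a b, G.Adj a b → lev a ≤ g → lev b ≤ g → lev b ≤ lev a + 1
  lev_le : ∀ a b, G.Adj a b → 0 < lev a → lev a < g → lev b ≤ g
  exists_up : ∀ a, lev a < g → ∃ b, G.Adj a b ∧ lev b = lev a + 1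
  exists_down : ∀ a, 0 < lev a → lev a ≤ g → ∃ b, G.Adj a b ∧ lev b + 1 = lev a

/-- The graph obtained from the levels `0, …, g` by identifying `y` with `x`. -/
def stripClosure (G : SimpleGraph V) (g : ℕ) (lev : V → ℕ) (x y : V) :
    SimpleGraph {a // lev a < g} :=
  SimpleGraph.fromRel fun a b ↦ G.Adj a b ∨ a.1 = x ∧ G.Adj y b

theorem SimpleGraph.Walk.IsPath.egirth_le_length_add_one {a b : V} {p : G.Walk a b}
    (hp : p.IsPath) (h : G.Adj a b) (hlen : 2 ≤ p.length) : G.egirth ≤ (p.length + 1 : ℕ) := by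
  have := hp.egirth_le_length_add_length (Path.singleton h).2 (fun h ↦ by
    rw [h] at hlen; simp [Path.singleton] at hlen)
  simpa [Path.singleton] using this

namespace IsStrip

theorem lev_left (hs : IsStrip G g lev x y) : lev x = 0 := (hs.lev_eq_zero x).2 rfl

theorem lev_right (hs : IsStrip G g lev x y) : lev y = g := (hs.lev_eq_top y).2 rfl

theorem left_lt (hs : IsStrip G g lev x y) : lev x < g := by
  have := hs.lev_left
  have := hs.three_le
  omega

theorem closure_adj {a b : {a // lev a < g}} (h : (stripClosure G g lev x y).Adj a b) :
    G.Adj a b ∨ a.1 = x ∧ G.Adj y b ∨ b.1 = x ∧ G.Adj y a := by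
  rw [stripClosure, fromRel_adj] at h
  rcases h with ⟨-, (h | h) | (h | h)⟩
  · exact .inl h
  · exact .inr (.inl h)
  · exact .inl h.symm
  · exact .inr (.inr h)

theorem closure_adj_of_adj {a b : {a // lev a < g}} (h : G.Adj a b) :
    (stripClosure G g lev x y).Adj a b := by
  rw [stripClosure, fromRel_adj]
  exact ⟨fun hab ↦ h.ne (congrArg _ hab), .inl (.inl h)⟩

theorem closure_adj_left (hs : IsStrip G g lev x y) {b : {a // lev a < g}} (h : G.Adj y b) :
    (stripClosure G g lev x y).Adj ⟨x, hs.left_lt⟩ b := by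
  rw [stripClosure, fromRel_adj]
  refine ⟨fun hb ↦ ?_, .inl (.inr ⟨rfl, h⟩)⟩
  have := hs.lev_le_succ b y h.symm b.2.le hs.lev_right.le
  rw [← hb, hs.lev_left, hs.lev_right] at this
  have := hs.three_le
  omega

theorem exists_walk_of_avoid {a b : {a // lev a < g}} (p : (stripClosure G g lev x y).Walk a b)
    (hp : ∀ w ∈ p.support, w.1 ≠ x) :
    ∃ r : G.Walk a b, r.length = p.length ∧ r.support = p.support.map Subtype.val := by
  induction p with
  | nil => exact ⟨.nil, by simp⟩
  | @cons u v w h p ih =>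
    obtain ⟨r, hr, hr'⟩ := ih fun w hw ↦ hp w (by simp [hw])
    have hu := hp u (by simp)
    have hv := hp v (by simp)
    have hadj : G.Adj u v := by
      have := closure_adj h
      tauto
    exact ⟨r.cons hadj, by simp [hr], by simp [hr']⟩

/-- A path of the closure that ends in the identified vertex lifts to a path of `G` that ends in
`x` or in `y`. -/
theorem exists_path_lift (hs : IsStrip G g lev x y) {a b : {a // lev a < g}}
    (p : (stripClosure G g lev x y).Walk a b) (hb : b.1 = x) (hp : p.IsPath) (ha : a.1 ≠ x) :
    (∃ r : G.Walk a x, r.IsPath ∧ r.length = p.length ∧ lev a ≤ p.length ∧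
      ∀ z ∈ r.support, ∃ w ∈ p.support, w.1 = z) ∨
    (∃ r : G.Walk a y, r.IsPath ∧ r.length = p.length ∧ g ≤ lev a + p.length ∧
      ∀ z ∈ r.support, z = y ∨ ∃ w ∈ p.support, w.1 = z) := by
  induction p with
  | nil => exact absurd hb ha
  | @cons u v w h p ih =>
    rw [Walk.cons_isPath_iff] at hp
    by_cases hv : v.1 = x
    · obtain rfl : v = w := Subtype.ext (hv.trans hb.symm)
      obtain rfl : p = .nil := (Walk.isPath_iff_nil.1 hp.1).eq_nil
      rcases closure_adj h with h' | ⟨h', -⟩ | ⟨-, h'⟩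
      · left
        rw [hv] at h'
        refine ⟨h'.toWalk, by simp [Walk.cons_isPath_iff, h'.ne], by simp, ?_, ?_⟩
        · have := hs.lev_le_succ _ _ h'.symm hs.left_lt.le u.2.le
          rw [hs.lev_left] at this
          simpa using this
        · intro z hz
          simp only [Walk.support_cons, Walk.support_nil, List.mem_cons, List.not_mem_nil,
            or_false] at hz
          rcases hz with rfl | rfl
          · exact ⟨u, by simp, rfl⟩
          · exact ⟨v, by simp, hv⟩
      · exact absurd h' ha
      · right
        refine ⟨h'.symm.toWalk, by simp [Walk.cons_isPath_iff, h'.ne'], by simp, ?_, ?_⟩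
        · have := hs.lev_le_succ _ _ h'.symm u.2.le hs.lev_right.le
          rw [hs.lev_right] at this
          simpa using this
        · intro z hz
          simp only [Walk.support_cons, Walk.support_nil, List.mem_cons, List.not_mem_nil,
            or_false] at hz
          rcases hz with rfl | rfl
          · exact .inr ⟨u, by simp, rfl⟩
          · exact .inl rfl
    · have hadj : G.Adj u v := by
        have := closure_adj h
        tauto
      have h1 := hs.lev_le_succ _ _ hadj u.2.le v.2.le
      have h2 := hs.lev_le_succ _ _ hadj.symm v.2.le u.2.le
      rcases ih hb hp.1 hv with ⟨r, hr, hrl, hlev, hsup⟩ | ⟨r, hr, hrl, hlev, hsup⟩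
      · left
        refine ⟨r.cons hadj, (Walk.cons_isPath_iff _ _).2 ⟨hr, fun hu ↦ ?_⟩, by simp [hrl],
          by rw [Walk.length_cons]; omega, ?_⟩
        · obtain ⟨w, hw, hwu⟩ := hsup _ hu
          exact hp.2 (Subtype.ext hwu ▸ hw)
        · intro z hz
          rw [Walk.support_cons, List.mem_cons] at hz
          rcases hz with rfl | hz
          · exact ⟨u, by simp, rfl⟩
          · obtain ⟨w, hw, hwz⟩ := hsup z hz
            exact ⟨w, by simp [hw], hwz⟩
      · right
        refine ⟨r.cons hadj, (Walk.cons_isPath_iff _ _).2 ⟨hr, fun hu ↦ ?_⟩, by simp [hrl],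
          by rw [Walk.length_cons]; omega, ?_⟩
        · rcases hsup _ hu with hu | ⟨w, hw, hwu⟩
          · have := u.2
            rw [hu, hs.lev_right] at this
            exact this.false
          · exact hp.2 (Subtype.ext hwu ▸ hw)
        · intro z hz
          rw [Walk.support_cons, List.mem_cons] at hz
          rcases hz with rfl | hz
          · exact .inr ⟨u, by simp, rfl⟩
          · rcases hsup z hz with hz | ⟨w, hw, hwz⟩
            · exact .inl hz
            · exact .inr ⟨w, by simp [hw], hwz⟩

theorem le_egirth_closure (hs : IsStrip G g lev x y) (hg : (g : ℕ∞) ≤ G.egirth) :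
    (g : ℕ∞) ≤ (stripClosure G g lev x y).egirth := by
  classical
  rw [le_egirth]
  intro a c hc
  norm_cast
  have hclose : ∀ {u v : V} (r : G.Walk u v), r.IsPath → G.Adj u v → 2 ≤ r.length →
      g ≤ r.length + 1 := fun r hr h h2 ↦ by
    exact_mod_cast hg.trans (hr.egirth_le_length_add_one h h2)
  by_cases hx : (⟨x, hs.left_lt⟩ : {a // lev a < g}) ∈ c.support
  · have hc' := hc.rotate hx
    rw [← Walk.length_rotate c _ hx]
    revert hc'
    generalize c.rotate _ hx = c'
    intro hc'
    have hlen := hc'.three_le_length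
    cases c' with
    | nil => simp at hlen
    | @cons _ v _ h p =>
      rw [Walk.cons_isCycle_iff] at hc'
      rw [Walk.length_cons] at hlen ⊢
      have hv : v.1 ≠ x := fun hv ↦ h.ne (Subtype.ext hv.symm)
      have hedge : G.Adj x v ∨ G.Adj y v := by
        have := closure_adj h
        tauto
      rcases hs.exists_path_lift p rfl hc'.1 hv with ⟨r, hr, hrl, hlev, -⟩ | ⟨r, hr, hrl, hlev, -⟩
      · rcases hedge with h' | h'
        · have := hclose r hr h'.symm (by omega)
          omega
        · have := hs.lev_le_succ _ _ h'.symm v.2.le hs.lev_right.le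
          rw [hs.lev_right] at this
          omega
      · rcases hedge with h' | h'
        · have := hs.lev_le_succ _ _ h' hs.left_lt.le v.2.le
          rw [hs.lev_left] at this
          omega
        · have := hclose r hr h'.symm (by omega)
          omega
  · have hlen := hc.three_le_length
    have hne : ∀ w ∈ c.support, w.1 ≠ x := fun w hw hwx ↦ hx (by
      convert hw; exact hwx.symm)
    cases c with
    | nil => simp at hlen
    | @cons _ v _ h p =>
      rw [Walk.cons_isCycle_iff] at hc
      rw [Walk.length_cons] at hlen ⊢
      obtain ⟨r, hrl, hrs⟩ := exists_walk_of_avoid p fun w hw ↦ hne w (by simp [hw])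
      have hr : r.IsPath := by
        rw [Walk.isPath_def, hrs]
        exact hc.1.support_nodup.map Subtype.val_injective
      have hadj : G.Adj a v := by
        have h1 := hne a (by simp)
        have h2 := hne v (by simp)
        have := closure_adj h
        tauto
      have := hclose r hr hadj.symm (by omega)
      omega

theorem exists_path_to_left (hs : IsStrip G g lev x y) (n : ℕ) (a : {a // lev a < g})
    (ha : lev a = n) :
    ∃ p : (stripClosure G g lev x y).Walk a ⟨x, hs.left_lt⟩, p.IsPath ∧ p.length = n ∧
      ∀ w ∈ p.support, lev w ≤ n := by
  induction n generalizing a with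
  | zero =>
    obtain rfl : a = ⟨x, hs.left_lt⟩ := Subtype.ext ((hs.lev_eq_zero a).1 ha)
    exact ⟨.nil, by simp [hs.lev_left]⟩
  | succ n ih =>
    have ha' := a.2
    obtain ⟨b, hab, hb⟩ := hs.exists_down a (by omega) a.2.le
    obtain ⟨p, hp, hpl, hps⟩ := ih ⟨b, by omega⟩ (by simp only; omega)
    refine ⟨p.cons (closure_adj_of_adj hab), (Walk.cons_isPath_iff _ _).2 ⟨hp, fun hmem ↦ ?_⟩,
      by simp [hpl], fun w hw ↦ ?_⟩
    · have := hps a hmem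
      omega
    · rw [Walk.support_cons, List.mem_cons] at hw
      rcases hw with rfl | hw
      · exact ha.le
      · exact (hps w hw).trans (by omega)

theorem connected_closure (hs : IsStrip G g lev x y) : (stripClosure G g lev x y).Connected := by
  have : Nonempty {a // lev a < g} := ⟨⟨x, hs.left_lt⟩⟩
  refine ⟨fun a b ↦ ?_⟩
  obtain ⟨p, -⟩ := hs.exists_path_to_left _ a rfl
  obtain ⟨r, -⟩ := hs.exists_path_to_left _ b rfl
  exact p.reachable.trans r.reachable.symm

theorem girth_closure (hs : IsStrip G g lev x y) (hg : (g : ℕ∞) ≤ G.egirth) :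
    (stripClosure G g lev x y).girth = g := by
  have h3 := hs.three_le
  obtain ⟨b, hyb, hb⟩ := hs.exists_down y (by rw [hs.lev_right]; omega) hs.lev_right.le
  rw [hs.lev_right] at hb
  obtain ⟨p, hp, hpl, -⟩ := hs.exists_path_to_left (g - 1) ⟨b, by omega⟩ (by simp only; omega)
  have hle := hp.egirth_le_length_add_one
    (hs.closure_adj_left (b := ⟨b, by omega⟩) hyb).symm (by omega)
  rw [hpl, Nat.sub_add_cancel (by omega)] at hle
  rw [girth, le_antisymm hle (hs.le_egirth_closure hg), ENat.toNat_natCast]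

theorem ndeg_le_ndeg_closure [Finite V] (hs : IsStrip G g lev x y) (a : {a // lev a < g})
    (ha : a.1 ≠ x) : ndeg G a ≤ ndeg (stripClosure G g lev x y) a := by
  classical
  have h3 := hs.three_le
  have ha0 : 0 < lev a := Nat.pos_of_ne_zero fun h ↦ ha ((hs.lev_eq_zero a).1 h)
  have htop : ∀ b, G.Adj a b → ¬ lev b < g → b = y := fun b hab hb ↦
    (hs.lev_eq_top b).1 (le_antisymm (hs.lev_le _ _ hab ha0 a.2) (not_lt.1 hb))
  have hxy : G.Adj a x → G.Adj a y → False := fun h1 h2 ↦ by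
    have h1 := hs.lev_le_succ _ _ h1.symm hs.left_lt.le a.2.le
    have h2 := hs.lev_le_succ _ _ h2 a.2.le hs.lev_right.le
    rw [hs.lev_left] at h1
    rw [hs.lev_right] at h2
    omega
  refine Set.ncard_le_ncard_of_injOn
    (fun b ↦ if h : lev b < g then ⟨b, h⟩ else ⟨x, hs.left_lt⟩) ?_ ?_ (Set.toFinite _)
  · intro b hab
    rw [mem_neighborSet] at hab
    simp only [mem_neighborSet]
    split_ifs with hb
    · exact closure_adj_of_adj hab
    · obtain rfl := htop b hab hb
      exact (hs.closure_adj_left hab.symm).symm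
  · intro b hab c hac hbc
    rw [mem_neighborSet] at hab hac
    simp only at hbc
    split_ifs at hbc with hb hc hc
    · exact congrArg Subtype.val hbc
    · obtain rfl := htop c hac hc
      obtain rfl : b = x := congrArg Subtype.val hbc
      exact (hxy hab hac).elim
    · obtain rfl := htop b hab hb
      obtain rfl : x = c := congrArg Subtype.val hbc
      exact (hxy hac hab).elim
    · rw [htop b hab hb, htop c hac hc]

theorem le_ndeg_closure_left [Finite V] (hs : IsStrip G g lev x y) :
    {a | lev a = 1}.ncard + {a | lev a = g - 1}.ncard ≤
      ndeg (stripClosure G g lev x y) ⟨x, hs.left_lt⟩ := by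
  have h3 := hs.three_le
  rw [← Set.ncard_union_eq (Set.disjoint_left.2 fun a h1 h2 ↦ by
    simp only [Set.mem_ofPred_eq] at h1 h2; omega) (Set.toFinite _) (Set.toFinite _), ndeg,
    ← Set.ncard_image_of_injective _ Subtype.val_injective]
  refine Set.ncard_le_ncard ?_ (Set.toFinite _)
  rintro a (ha | ha) <;> simp only [Set.mem_ofPred_eq] at ha
  · refine ⟨⟨a, by omega⟩, ?_, rfl⟩
    obtain ⟨b, hab, hb⟩ := hs.exists_down a (by omega) (by omega)
    obtain rfl := (hs.lev_eq_zero b).1 (by omega)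
    exact closure_adj_of_adj hab.symm
  · refine ⟨⟨a, by omega⟩, ?_, rfl⟩
    obtain ⟨b, hab, hb⟩ := hs.exists_up a (by omega)
    obtain rfl := (hs.lev_eq_top b).1 (by omega)
    exact hs.closure_adj_left hab.symm

end IsStrip

end Strip

section Equatorial

variable {V : Type*} {G : SimpleGraph V} {g k q : ℕ} {f : ZMod q → V}

namespace IsLevel

theorem eq_of_dist_le (hq : 6 * k + 3 < q) {v : V} {c i : ZMod q}
    (hc : IsLevel G g k f v c) (h1 : G.dist (f (i - k)) v ≤ k) (h2 : G.dist (f (i + k)) v ≤ k) :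
    c = i := by
  obtain ⟨a, ha, ha'⟩ := hc.exists_of_dist_le _ h1
  obtain ⟨b, hb, hb'⟩ := hc.exists_of_dist_le _ h2
  rw [abs_le] at ha hb
  have h : b = a + 2 * k := ZMod.eq_of_intCast_eq (q := q)
    (by push_cast; linear_combination ha' - hb') (by rw [abs_lt]; omega)
  obtain rfl : a = -k := by omega
  push_cast at ha'
  linear_combination -ha'

theorem cycle (hf : IsIsoCycle G q f) (hq : 6 * k + 3 < q) {i c : ZMod q}
    (hc : IsLevel G g k f (f i) c) : c = i := by
  have h (j : ZMod q) : G.dist (f j) (f (j + k)) ≤ k := by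
    rw [hf.2]; exact cycleDist_add_natCast_le j k
  refine hc.eq_of_dist_le hq ?_ ?_
  · simpa using h (i - k)
  · rw [dist_comm]; exact h i

theorem exists_of_adj (hf : IsIsoCycle G q f) (hG : G.Connected) (hq : 6 * k + 3 < q) {v w : V}
    {c d : ZMod q} (hc : IsLevel G g k f v c) (hd : IsLevel G g k f w d) (h : G.Adj v w) :
    ∃ e : ℤ, |e| ≤ 1 ∧ d = c + e := by
  have := hf.neZero
  have h1 := (dist_eq_one_iff_adj.2 h).le
  obtain ⟨e, he, he'⟩ := exists_int_of_cycleDist_le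
    (hf.cycleDist_le hG hc.dist_sub hd.dist_sub h1)
  obtain ⟨a, ha, ha'⟩ := exists_int_of_cycleDist_le
    (hf.cycleDist_le hG hc.dist_sub hd.dist_add h1)
  obtain ⟨b, hb, hb'⟩ := exists_int_of_cycleDist_le
    (hf.cycleDist_le hG hc.dist_add hd.dist_sub h1)
  rw [abs_le] at ha hb he
  push_cast at ha hb he
  have hea : a = e + 2 * k := ZMod.eq_of_intCast_eq (q := q)
    (by push_cast; linear_combination he' - ha') (by rw [abs_lt]; omega)
  have heb : b = e - 2 * k := ZMod.eq_of_intCast_eq (q := q)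
    (by push_cast; linear_combination he' - hb') (by rw [abs_lt]; omega)
  exact ⟨e, by rw [abs_le]; omega, by linear_combination he'⟩

/-- The neighbour of `v` towards the vertex `f (c + σ k)` of the cycle is on level `c + σ`. -/
theorem exists_adj (hf : IsIsoCycle G q f) (hG : G.Connected) (hk : 0 < k) (hq : 6 * k + 3 < q)
    {lv : V → ZMod q} (hlv : ∀ v, IsLevel G g k f v (lv v)) (v : V) (σ : ℤ) (hσ : σ = 1 ∨ σ = -1) :
    ∃ w, G.Adj v w ∧ lv w = lv v + σ := by
  have := hf.neZero
  have hdist : G.dist v (f (lv v + (σ * k : ℤ))) ≤ k := by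
    rw [dist_comm]
    rcases hσ with rfl | rfl
    · simpa using (hlv v).dist_add
    · simpa [← sub_eq_add_neg] using (hlv v).dist_sub
  obtain ⟨p, hp⟩ := hG.exists_walk_length_eq_dist v (f (lv v + (σ * k : ℤ)))
  have hne : v ≠ f (lv v + (σ * k : ℤ)) := fun h ↦ by
    have h1 := (h ▸ hlv v : IsLevel G g k f (f (lv v + (σ * k : ℤ))) (lv v)).cycle hf hq
    have := ZMod.eq_of_intCast_eq (q := q) (a := 0) (b := σ * k)
      (by push_cast at h1 ⊢; linear_combination h1)
      (by rw [abs_lt]; rcases hσ with rfl | rfl <;> omega)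
    rcases hσ with rfl | rfl <;> omega
  obtain ⟨w, h, p, rfl⟩ := Walk.exists_eq_cons_of_ne hne p
  refine ⟨w, h, ?_⟩
  rw [Walk.length_cons] at hp
  have hw : G.dist (f (lv v + (σ * k : ℤ) + σ)) w ≤ k := by
    have h1 := dist_le p
    have h2 := hG.dist_triangle (u := w) (v := f (lv v + (σ * k : ℤ)))
      (w := f (lv v + (σ * k : ℤ) + σ))
    have h3 : G.dist (f (lv v + (σ * k : ℤ))) (f (lv v + (σ * k : ℤ) + σ)) ≤ 1 := by
      rcases hσ with rfl | rfl
      · rw [dist_eq_one_iff_adj.2]; simpa using hf.adj _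
      · rw [dist_comm, dist_eq_one_iff_adj.2]
        simpa using hf.adj (lv v + ((-1 * k : ℤ) : ZMod q) + ((-1 : ℤ) : ZMod q))
    rw [dist_comm]
    omega
  obtain ⟨a, ha, ha'⟩ := (hlv w).exists_of_dist_le _ hw
  obtain ⟨e, he, he'⟩ := (hlv v).exists_of_adj hf hG hq (hlv w) h
  rw [abs_le] at ha he
  have : a + e = σ * k + σ := ZMod.eq_of_intCast_eq (q := q)
    (by push_cast at ha' ⊢; linear_combination -ha' - he')
    (by rw [abs_lt]; rcases hσ with rfl | rfl <;> omega)
  obtain rfl : e = σ := by rcases hσ with rfl | rfl <;> omega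
  exact he'

theorem lpart_eq (hq : 6 * k + 3 < q) {lv : V → ZMod q} (hlv : ∀ v, IsLevel G g k f v (lv v))
    (i : ZMod q) : Lpart G k f i = {v | lv v = i} := by
  ext v
  constructor
  · rintro ⟨h1, h2⟩
    exact (hlv v).eq_of_dist_le hq h1 h2
  · rintro rfl
    exact ⟨(hlv v).dist_sub, (hlv v).dist_add⟩

end IsLevel

/-- If the levels in any window of length `g` contain the same number of vertices in total, then
the level sizes are periodic. -/
theorem ncard_level_add [Finite V] {M : ℕ} {lv : V → ZMod q} (hgq : g ≤ q)
    (h : ∀ a : ZMod q, {v | ∃ j < g, lv v = a + (j : ℕ)}.ncard = M) (a : ZMod q) :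
    {v | lv v = a + (g : ℕ)}.ncard = {v | lv v = a}.ncard := by
  classical
  have := Fintype.ofFinite V
  have hcard : ∀ (p : V → Prop) [DecidablePred p], {x | p x}.ncard = (Finset.univ.filter p).card :=
    fun p _ ↦ by rw [← Set.ncard_coe_finset]; simp
  have hsum : ∀ a : ZMod q, ∑ j ∈ Finset.range g, {v | lv v = a + (j : ℕ)}.ncard = M := by
    intro a
    rw [← h a, hcard, Finset.sum_congr rfl fun j _ ↦ hcard _, ← Finset.card_biUnion]
    · congr 1
      ext v
      simp
    · intro i hi j hj hij
      simp only [Finset.coe_range, Set.mem_Iio] at hi hj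
      rw [Function.onFun, Finset.disjoint_left]
      intro v hv hv'
      simp only [Finset.mem_filter, Finset.mem_univ, true_and] at hv hv'
      have := ZMod.eq_of_intCast_eq (q := q) (a := i) (b := j)
        (by push_cast; linear_combination hv' - hv) (by rw [abs_lt]; omega)
      omega
  have h1 := hsum a
  have h2 := hsum (a + 1)
  have h3 := Finset.sum_range_succ (fun j : ℕ ↦ {v | lv v = a + (j : ℕ)}.ncard) g
  rw [Finset.sum_range_succ', h1] at h3
  have h4 : ∑ j ∈ Finset.range g, {v | lv v = a + ((j + 1 : ℕ) : ZMod q)}.ncard = M := by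
    rw [← h2]
    refine Finset.sum_congr rfl fun j _ ↦ ?_
    congr! 4
    push_cast
    ring
  rw [h4, Nat.cast_zero, add_zero] at h3
  omega

/-- A map to a cycle whose levels behave as in an equatorial graph restricts to a strip between two
levels that contain a single vertex. -/
theorem isStrip_of_level [NeZero q] {lv : V → ZMod q} (hg : 3 ≤ g) (hgq : g + 1 < q) {i : ZMod q}
    {x y : V} (hx : ∀ a, lv a = i ↔ a = x) (hy : ∀ a, lv a = i + g ↔ a = y)
    (hadj : ∀ v w, G.Adj v w → ∃ e : ℤ, |e| ≤ 1 ∧ lv w = lv v + e)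
    (hnext : ∀ v (σ : ℤ), σ = 1 ∨ σ = -1 → ∃ w, G.Adj v w ∧ lv w = lv v + σ) :
    IsStrip G g (fun v ↦ (lv v - i).val) x y := by
  have hval : ∀ v, ((lv v - i).val : ZMod q) = lv v - i := fun v ↦ ZMod.natCast_zmod_val _
  have hlt : ∀ v, (lv v - i).val < q := fun v ↦ ZMod.val_lt _
  have hstep : ∀ v w (e : ℤ), lv w = lv v + e →
      |((lv w - i).val : ℤ) - (lv v - i).val - e| < q →
      ((lv w - i).val : ℤ) = (lv v - i).val + e := fun v w e he hlt ↦ by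
    refine (ZMod.eq_of_intCast_eq (q := q) ?_ ?_).symm
    · push_cast
      rw [hval, hval, he]
      ring
    · rwa [← sub_sub]
  refine ⟨hg, fun a ↦ ?_, fun a ↦ ?_, fun a b hab ha hb ↦ ?_, fun a b hab ha0 ha ↦ ?_,
    fun a ha ↦ ?_, fun a ha0 ha ↦ ?_⟩
  · rw [ZMod.val_eq_zero, sub_eq_zero, hx]
  · rw [← hy]
    constructor
    · intro h
      have := hval a
      rw [h] at this
      linear_combination -this
    · intro h
      rw [h, add_sub_cancel_left, ZMod.val_natCast_of_lt (by omega)]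
  · obtain ⟨e, he, he'⟩ := hadj a b hab
    rw [abs_le] at he
    have := hstep a b e he' (by rw [abs_lt]; omega)
    omega
  · obtain ⟨e, he, he'⟩ := hadj a b hab
    rw [abs_le] at he
    have := hlt b
    have := hstep a b e he' (by rw [abs_lt]; omega)
    omega
  · obtain ⟨b, hab, hb⟩ := hnext a 1 (.inl rfl)
    have := hlt b
    have := hstep a b 1 hb (by rw [abs_lt]; omega)
    exact ⟨b, hab, by omega⟩
  · obtain ⟨b, hab, hb⟩ := hnext a (-1) (.inr rfl)
    have := hlt b
    have := hstep a b (-1) hb (by rw [abs_lt]; omega)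
    exact ⟨b, hab, by omega⟩

theorem val_sub_eq_iff [NeZero q] {c i : ZMod q} {n : ℕ} (hn : n < q) :
    (c - i).val = n ↔ c = i + n := by
  constructor
  · rintro rfl
    simp
  · rintro rfl
    rw [add_sub_cancel_left, ZMod.val_natCast_of_lt hn]

theorem ndeg_le_ncard_add_ncard [Finite V] {lv : V → ZMod q} {i : ZMod q} {x : V}
    (hx : ∀ a, lv a = i ↔ a = x) (hadj : ∀ v w, G.Adj v w → ∃ e : ℤ, |e| ≤ 1 ∧ lv w = lv v + e) :
    ndeg G x ≤ {v | lv v = i + 1}.ncard + {v | lv v = i - 1}.ncard := by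
  refine le_trans (Set.ncard_le_ncard ?_ (Set.toFinite _)) (Set.ncard_union_le _ _)
  intro w hw
  obtain ⟨e, he, he'⟩ := hadj x w hw
  rw [(hx x).2 rfl] at he'
  rw [abs_le] at he
  obtain rfl | rfl | rfl : e = 0 ∨ e = 1 ∨ e = -1 := by omega
  · rw [Int.cast_zero, add_zero, hx] at he'
    exact absurd he'.symm hw.ne
  · exact .inl (by simpa using he')
  · exact .inr (by simpa [← sub_eq_add_neg] using he')

theorem SimpleGraph.Iso.ndeg_eq {W : Type*} {H : SimpleGraph W} (e : G ≃g H) (v : V) :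
    ndeg H (e v) = ndeg G v := by
  rw [ndeg, ndeg, ← e.image_neighborSet, Set.ncard_image_of_injective _ e.injective]

end Equatorial

/-- Proposition 6.2: if some part of the partition of an equatorial graph induced by its
isometric `q`-cycles is a single vertex, then there exists a `δ`-regular Moore graph of
girth `g`. -/
theorem stmt_17 {V : Type*} (G : SimpleGraph V) (δ g q k : ℕ)
    (hG : IsEquatorial G δ g q) (hk : k = (g + 1) / 2 - 1)
    (f : ZMod q → V) (hf : IsIsoCycle G q f)
    (hsingle : ∃ i : ZMod q, (Lpart G k f i).ncard = 1) :
    ∃ (W : Type) (H : SimpleGraph W), Finite W ∧ H.Connected ∧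
      (∀ v : W, ndeg H v = δ) ∧ H.girth = g ∧ Nat.card W = mooreBound δ g := by
  classical
  obtain ⟨hfin, hconn, hgirth, ⟨hδ, v₀, hv₀⟩, -, hq, hcard⟩ := id hG
  have := hf.neZero
  have hg : 3 ≤ g := by
    rw [← hgirth]
    refine three_le_girth fun hac ↦ ?_
    rw [← girth_eq_zero, hgirth] at hac
    subst hac
    have := hf.1
    simp [mooreBound] at hcard
    omega
  have hegirth : (g : ℕ∞) ≤ G.egirth := le_egirth.2 fun a w hw ↦ by
    rw [← hgirth]; exact_mod_cast girth_le_length hw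
  rw [← hk] at hq
  obtain ⟨hlevel, hdisk⟩ := hG.levels hk hg hf
  choose lv hlv using hlevel
  have hadj : ∀ v w, G.Adj v w → ∃ e : ℤ, |e| ≤ 1 ∧ lv w = lv v + e := fun v w h ↦
    (hlv v).exists_of_adj hf hconn hq (hlv w) h
  have hnext := IsLevel.exists_adj hf hconn (by omega) hq hlv
  have hwindow : ∀ a : ZMod q, {v | ∃ j < g, lv v = a + (j : ℕ)}.ncard = mooreBound δ g := by
    intro a
    rw [← hdisk (a + k)]
    congr 1
    ext v
    rw [(hlv v).mem_cycleDisk_iff, add_sub_cancel_right, Set.mem_ofPred_eq]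
  have hperiod := ncard_level_add (by omega) hwindow
  have hδ0 : 0 < δ := by
    obtain ⟨w, hw, -⟩ := hnext v₀ 1 (.inl rfl)
    rw [← hv₀]
    exact (Set.ncard_pos (Set.toFinite _)).2 ⟨w, hw⟩
  obtain ⟨i, hi⟩ := hsingle
  rw [IsLevel.lpart_eq hq hlv] at hi
  have hi' := hi
  rw [← hperiod] at hi'
  obtain ⟨x, hx⟩ := Set.ncard_eq_one.1 hi
  obtain ⟨y, hy⟩ := Set.ncard_eq_one.1 hi'
  have hx : ∀ a, lv a = i ↔ a = x := fun a ↦ Set.ext_iff.1 hx a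
  have hy : ∀ a, lv a = i + g ↔ a = y := fun a ↦ Set.ext_iff.1 hy a
  have hs := isStrip_of_level (G := G) hg (by omega) hx hy hadj hnext
  set lev : V → ℕ := fun v ↦ (lv v - i).val with hlev
  have hlev_iff : ∀ n < q, ∀ v, lev v = n ↔ lv v = i + (n : ℕ) := fun n hn v ↦ val_sub_eq_iff hn
  have hcardW : Nat.card {a // lev a < g} = mooreBound δ g := by
    rw [← hwindow i]
    refine congrArg Set.ncard (Set.ext fun v ↦ ?_)
    constructor
    · intro h
      have h : lev v < g := h
      exact ⟨lev v, h, (hlev_iff _ (by omega) v).1 rfl⟩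
    · rintro ⟨j, hj, hvj⟩
      have := (hlev_iff j (by omega) v).2 hvj
      show lev v < g
      omega
  have hdegx : δ ≤ {a | lev a = 1}.ncard + {a | lev a = g - 1}.ncard := by
    refine (hδ x).trans ((ndeg_le_ncard_add_ncard hx hadj).trans_eq ?_)
    rw [← hperiod (i - 1)]
    simp only [hlev_iff 1 (by omega), hlev_iff (g - 1) (by omega)]
    rw [Nat.cast_sub (by omega), Nat.cast_one, sub_add_eq_add_sub, add_sub_assoc]
  have hdeg : ∀ a, δ ≤ ndeg (stripClosure G g lev x y) a := by
    intro a
    by_cases ha : a.1 = x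
    · obtain rfl : a = ⟨x, hs.left_lt⟩ := Subtype.ext ha
      exact hdegx.trans hs.le_ndeg_closure_left
    · exact (hδ a).trans (hs.ndeg_le_ndeg_closure a ha)
  have hreg := ndeg_eq_of_card_eq_mooreBound (hs.le_egirth_closure hegirth) hg hδ0 hdeg hcardW
  have := Fintype.ofFinite {a // lev a < g}
  let e := (stripClosure G g lev x y).overFinIso rfl
  refine ⟨_, _, inferInstance, e.connected_iff.1 hs.connected_closure, fun v ↦ ?_,
    e.girth_eq.symm.trans (hs.girth_closure hegirth), ?_⟩
  · obtain ⟨a, rfl⟩ := e.surjective v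
    rw [e.ndeg_eq, hreg]
  · rw [← hcardW, Nat.card_eq_fintype_card, Nat.card_eq_fintype_card, Fintype.card_fin]
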